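/- For every integer n ≥ 2, the polynomial Δ_n := A_{2,n} D_{2,n} − B_{2,n} C_{2,n} satisfies the identities Δ_n(x) P_n(x) = ρ(x) ( D_{2,n}(x) S_n(x) − B_{2,n}(x) S_{n−1}(x) ) and Δ_n(x) P_{n−1}(x) = ρ(x) ( A_{2,n}(x) S_{n−1}(x) − C_{2,n}(x) S_n(x) ); moreover ρ divides Δ_n, and for n ≥ d+1 the degree of Δ_n equals 2d. -/

import Mathlib

open Polynomial MeasureTheory Finset

noncomputable section

/-- The `k`-th derivative of a real polynomial. -/
def iterDeriv (k : ℕ) (f : Polynomial ℝ) : Polynomial ℝ := Polynomial.derivative^[k] f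

/-- The Jacobi measure `dμ^{α,β}(x) = (1-x)^α (1+x)^β dx` on `[-1,1]`. -/
def jacobiMeasure (α β : ℝ) : Measure ℝ :=
  (volume.restrict (Set.Icc (-1 : ℝ) 1)).withDensity
    fun x => ENNReal.ofReal ((1 - x) ^ α * (1 + x) ^ β)

/-- The Jacobi–Sobolev inner product
`⟨f,g⟩_S = ∫ f g dμ^{α,β} + ∑_{j=1}^N ∑_{k=0}^{d_j} λ_{j,k} f^{(k)}(c_j) g^{(k)}(c_j)`. -/
def sobolevIP (α β : ℝ) {N : ℕ} (c : Fin N → ℝ) (dd : Fin N → ℕ)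
    (lam : Fin N → ℕ → ℝ) (f g : Polynomial ℝ) : ℝ :=
  (∫ x, f.eval x * g.eval x ∂(jacobiMeasure α β)) +
    ∑ j : Fin N, ∑ k ∈ Finset.range (dd j + 1),
      lam j k * (iterDeriv k f).eval (c j) * (iterDeriv k g).eval (c j)

/-- The degree-`k` Taylor polynomial of `f` centred at `c`:
`Q_k(x,c;f) = ∑_{ν=0}^k f^{(ν)}(c)(x-c)^ν/ν!` (as a polynomial in `x`). -/
def taylorPoly (k : ℕ) (c : ℝ) (f : Polynomial ℝ) : Polynomial ℝ :=
  ∑ ν ∈ Finset.range (k + 1),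
    Polynomial.C ((iterDeriv ν f).eval c / Nat.factorial ν) * (X - Polynomial.C c) ^ ν

/-- `ρ(x) = ∏_{j=1}^N (x-c_j)^{d_j+1}`. -/
def rhoPoly {N : ℕ} (c : Fin N → ℝ) (dd : Fin N → ℕ) : Polynomial ℝ :=
  ∏ j : Fin N, (X - Polynomial.C (c j)) ^ (dd j + 1)

/-- `ρ_{j,k}(x) = ρ(x)/(x-c_j)^{k+1} = (x-c_j)^{d_j-k} ∏_{i≠j} (x-c_i)^{d_i+1}`. -/
def rhoJK {N : ℕ} (c : Fin N → ℝ) (dd : Fin N → ℕ) (j : Fin N) (k : ℕ) : Polynomial ℝ :=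
  (X - Polynomial.C (c j)) ^ (dd j - k) *
    ∏ i ∈ Finset.univ.erase j, (X - Polynomial.C (c i)) ^ (dd i + 1)

/-- `â_n(x) = -n((2n+α+β)x+β-α)/(2n+α+β)`. -/
def ahat (α β : ℝ) (n : ℕ) : Polynomial ℝ :=
  Polynomial.C (-(n : ℝ) / (2 * (n : ℝ) + α + β)) *
    (Polynomial.C (2 * (n : ℝ) + α + β) * X + Polynomial.C (β - α))

/-- `b̂_n = 4n(n+α)(n+β)(n+α+β)/((2n+α+β)²(2n+α+β-1))`. -/
def bhat (α β : ℝ) (n : ℕ) : ℝ :=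
  4 * (n : ℝ) * ((n : ℝ) + α) * ((n : ℝ) + β) * ((n : ℝ) + α + β) /
    ((2 * (n : ℝ) + α + β) ^ 2 * (2 * (n : ℝ) + α + β - 1))

/-- `ĉ_n(x) = (n+α+β)((2n+α+β)x+α-β)/(2n+α+β)`. -/
def chat (α β : ℝ) (n : ℕ) : Polynomial ℝ :=
  Polynomial.C (((n : ℝ) + α + β) / (2 * (n : ℝ) + α + β)) *
    (Polynomial.C (2 * (n : ℝ) + α + β) * X + Polynomial.C (α - β))

/-- `d̂_n = -(2n+α+β-1)`. -/
def dhat (α β : ℝ) (n : ℕ) : ℝ := -(2 * (n : ℝ) + α + β - 1)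

/-- `γ_{1,n} = (β²-α²)/((2n+α+β)(2n+α+β+2))`. -/
def gamma1 (α β : ℝ) (n : ℕ) : ℝ :=
  (β ^ 2 - α ^ 2) / ((2 * (n : ℝ) + α + β) * (2 * (n : ℝ) + α + β + 2))

/-- `γ_{2,n} = 4n(n+α)(n+β)(n+α+β)/((2n+α+β)²((2n+α+β)²-1))`. -/
def gamma2 (α β : ℝ) (n : ℕ) : ℝ :=
  4 * (n : ℝ) * ((n : ℝ) + α) * ((n : ℝ) + β) * ((n : ℝ) + α + β) /
    ((2 * (n : ℝ) + α + β) ^ 2 * ((2 * (n : ℝ) + α + β) ^ 2 - 1))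

section JacobiMeasure

theorem intervalIntegrable_one_add_rpow {β : ℝ} (hβ : -1 < β) (a b : ℝ) :
    IntervalIntegrable (fun x : ℝ => (1 + x) ^ β) volume a b := by
  have := (intervalIntegral.intervalIntegrable_rpow' (a := a + 1) (b := b + 1) hβ).comp_add_left 1
  simpa using this

theorem intervalIntegrable_one_sub_rpow {α : ℝ} (hα : -1 < α) (a b : ℝ) :
    IntervalIntegrable (fun x : ℝ => (1 - x) ^ α) volume a b := by
  have := (intervalIntegral.intervalIntegrable_rpow' (a := 1 - a) (b := 1 - b) hα).comp_sub_left 1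
  simpa using this

theorem intervalIntegrable_jacobiWeight {α β : ℝ} (hα : -1 < α) (hβ : -1 < β) :
    IntervalIntegrable (fun x : ℝ => (1 - x) ^ α * (1 + x) ^ β) volume (-1) 1 := by
  refine IntervalIntegrable.trans (b := 0) ?_ ?_
  · refine (intervalIntegrable_one_add_rpow hβ _ _).continuousOn_mul ?_
    refine ContinuousOn.rpow_const (by fun_prop) fun x hx => Or.inl ?_
    rw [Set.uIcc_of_le (by norm_num)] at hx
    have := hx.2
    linarith
  · refine (intervalIntegrable_one_sub_rpow hα _ _).mul_continuousOn ?_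
    refine ContinuousOn.rpow_const (by fun_prop) fun x hx => Or.inl ?_
    rw [Set.uIcc_of_le (by norm_num)] at hx
    have := hx.1
    linarith

theorem isFiniteMeasure_jacobiMeasure {α β : ℝ} (hα : -1 < α) (hβ : -1 < β) :
    IsFiniteMeasure (jacobiMeasure α β) := by
  have := intervalIntegrable_jacobiWeight hα hβ
  rw [intervalIntegrable_iff_integrableOn_Icc_of_le (by norm_num)] at this
  exact isFiniteMeasure_withDensity_ofReal this.2

theorem ae_mem_Icc_jacobiMeasure (α β : ℝ) :
    ∀ᵐ x ∂(jacobiMeasure α β), x ∈ Set.Icc (-1 : ℝ) 1 :=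
  (withDensity_absolutelyContinuous _ _).ae_le (ae_restrict_mem measurableSet_Icc)

theorem integrable_eval_jacobiMeasure {α β : ℝ} (hα : -1 < α) (hβ : -1 < β) (p : ℝ[X]) :
    Integrable (fun x => p.eval x) (jacobiMeasure α β) := by
  have := isFiniteMeasure_jacobiMeasure hα hβ
  obtain ⟨M, hM⟩ := (isCompact_Icc (a := (-1 : ℝ)) (b := 1)).exists_bound_of_continuousOn
    (f := fun x => p.eval x) p.continuous.continuousOn
  refine Integrable.of_bound p.continuous.aestronglyMeasurable M ?_
  filter_upwards [ae_mem_Icc_jacobiMeasure α β] with x hx using hM x hx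

/-- Integration of polynomials against the Jacobi measure. -/
def jacobiFunctional {α β : ℝ} (hα : -1 < α) (hβ : -1 < β) : ℝ[X] →ₗ[ℝ] ℝ where
  toFun p := ∫ x, p.eval x ∂(jacobiMeasure α β)
  map_add' p q := by
    simp only [eval_add]
    exact integral_add (integrable_eval_jacobiMeasure hα hβ p)
      (integrable_eval_jacobiMeasure hα hβ q)
  map_smul' r p := by
    simp only [eval_smul, smul_eq_mul, RingHom.id_apply]
    exact integral_const_mul _ _

theorem jacobiFunctional_mul_self_pos {α β : ℝ} (hα : -1 < α) (hβ : -1 < β) {p : ℝ[X]}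
    (hp : p ≠ 0) : 0 < jacobiFunctional hα hβ (p * p) := by
  have hnonneg : 0 ≤ fun x => (p * p).eval x := fun x => by
    simpa using mul_self_nonneg (p.eval x)
  refine lt_of_le_of_ne (integral_nonneg hnonneg) fun h0 => hp ?_
  have hae := (integral_eq_zero_iff_of_nonneg hnonneg
    (integrable_eval_jacobiMeasure hα hβ (p * p))).1 h0.symm
  have hae' : ∀ᵐ x ∂(volume.restrict (Set.Ioo (-1 : ℝ) 1)), p.eval x = 0 := by
    have hmeas : Measurable fun x : ℝ => ENNReal.ofReal ((1 - x) ^ α * (1 + x) ^ β) := by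
      fun_prop
    have h1 := ae_restrict_of_ae_restrict_of_subset Set.Ioo_subset_Icc_self
      ((ae_withDensity_iff hmeas).1 hae)
    filter_upwards [h1, ae_restrict_mem measurableSet_Ioo] with x hx hmem
    have hpos : 0 < (1 - x) ^ α * (1 + x) ^ β :=
      mul_pos (Real.rpow_pos_of_pos (by linarith [hmem.2]) _)
        (Real.rpow_pos_of_pos (by linarith [hmem.1]) _)
    have := hx (by simpa using hpos)
    simpa using this
  refine eq_zero_of_infinite_isRoot p fun hfin => ?_
  have hnull : volume (Set.Ioo (-1 : ℝ) 1 \ {x | p.IsRoot x}) = 0 := by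
    rw [ae_restrict_iff' measurableSet_Ioo] at hae'
    refine measure_mono_null ?_ hae'
    intro x hx
    simpa [and_assoc] using hx
  rw [measure_sdiff_null (hfin.measure_zero _)] at hnull
  norm_num at hnull

end JacobiMeasure

section OrthogonalPolynomials

/-- A linear functional vanishing on a graded monic family up to degree `n` vanishes on all
polynomials of degree less than `n`. -/
theorem LinearMap.eq_zero_of_monic_family (φ : ℝ[X] →ₗ[ℝ] ℝ) {P : ℕ → ℝ[X]}
    (hPm : ∀ m, (P m).Monic) (hPd : ∀ m, (P m).natDegree = m) {n : ℕ}
    (hφ : ∀ i < n, φ (P i) = 0) (q : ℝ[X]) (hq : q.degree < n) : φ q = 0 := by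
  induction n generalizing q with
  | zero => simp [show q = 0 by simpa using hq]
  | succ n ih =>
    have hq' : q.degree ≤ n := by
      rw [degree_le_iff_coeff_zero]
      intro m hm
      rw [degree_lt_iff_coeff_zero] at hq
      exact hq m (by exact_mod_cast hm)
    have hr : (q - q.coeff n • P n).degree < n := by
      rw [degree_lt_iff_coeff_zero]
      intro m hm
      rcases hm.eq_or_lt with rfl | hm
      · have := (hPm n).coeff_natDegree
        rw [hPd] at this
        simp [this]
      · rw [degree_le_iff_coeff_zero] at hq'
        simp [hq' m (by exact_mod_cast hm),
          coeff_eq_zero_of_natDegree_lt (show (P n).natDegree < m by rw [hPd]; exact hm)]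
    have := ih (fun i hi => hφ i (by omega)) _ hr
    rw [map_sub, map_smul, hφ n (by omega)] at this
    simpa using this

theorem degree_lt_of_monic_sub {p q : ℝ[X]} {n : ℕ} (hp : p.Monic) (hq : q.Monic)
    (hpd : p.natDegree = n) (hqd : q.natDegree = n) : (p - q).degree < n := by
  have h1 : p.degree = n := by rw [degree_eq_natDegree hp.ne_zero, hpd]
  have h2 : q.degree = n := by rw [degree_eq_natDegree hq.ne_zero, hqd]
  rw [← h1]
  exact degree_sub_lt_left (h1.trans h2.symm) hp.ne_zero (by rw [hp.leadingCoeff, hq.leadingCoeff])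

/-- The reproducing-kernel type expansion `∑_{i<n} F(P_i) P_i / h_i` attached to `F`. -/
def kernelPoly (P : ℕ → ℝ[X]) (h : ℕ → ℝ) (n : ℕ) (F : ℕ → ℝ) : ℝ[X] :=
  ∑ i ∈ range n, C (F i / h i) * P i

theorem degree_kernelPoly_lt {P : ℕ → ℝ[X]}
    (hPd : ∀ m, (P m).natDegree = m) (h : ℕ → ℝ) (n : ℕ) (F : ℕ → ℝ) :
    (kernelPoly P h n F).degree < n := by
  rw [degree_lt_iff_coeff_zero]
  intro m hm
  rw [kernelPoly, finsetSum_coeff]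
  refine sum_eq_zero fun i hi => ?_
  rw [coeff_C_mul, coeff_eq_zero_of_natDegree_lt, mul_zero]
  rw [hPd]
  have := mem_range.1 hi
  omega

variable {L : ℝ[X] →ₗ[ℝ] ℝ} {P : ℕ → ℝ[X]} {h : ℕ → ℝ}

theorem functional_kernelPoly_mul (hPo : ∀ m l, m ≠ l → L (P m * P l) = 0)
    (hh : ∀ m, h m = L (P m * P m)) (hne : ∀ m, h m ≠ 0) (F : ℕ → ℝ) {n i : ℕ} (hi : i < n) :
    L (kernelPoly P h n F * P i) = F i := by
  rw [kernelPoly, sum_mul, map_sum, sum_eq_single_of_mem i (mem_range.2 hi)]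
  · rw [mul_assoc, ← smul_eq_C_mul, map_smul, ← hh, smul_eq_mul, div_mul_cancel₀ _ (hne i)]
  · intro j _ hj
    rw [mul_assoc, ← smul_eq_C_mul, map_smul, hPo j i hj, smul_zero]

/-- Christoffel–Darboux formula for a pair of functionals compatible with the recurrence. -/
theorem christoffelDarboux {a b : ℕ → ℝ} {a₀ : ℝ} (hne : ∀ m, h m ≠ 0)
    (h0 : X * P 0 = P 1 + C a₀ * P 0)
    (hrec : ∀ m, X * P (m + 1) = P (m + 2) + C (a (m + 1)) * P (m + 1) + C (b (m + 1)) * P m)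
    (hb : ∀ m, b (m + 1) * h m = h (m + 1)) {c : ℝ} {p q : ℕ → ℝ}
    (hp0 : c * p 0 + q 0 = p 1 + a₀ * p 0)
    (hp : ∀ m, c * p (m + 1) + q (m + 1) =
      p (m + 2) + a (m + 1) * p (m + 1) + b (m + 1) * p m) (n : ℕ) :
    (X - C c) * kernelPoly P h (n + 1) p - kernelPoly P h (n + 1) q =
      C (1 / h n) * (C (p n) * P (n + 1) - C (p (n + 1)) * P n) := by
  induction n with
  | zero =>
    have e : C (q 0) = C (p 1) + C a₀ * C (p 0) - C c * C (p 0) := by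
      rw [← C_mul, ← C_mul, ← C_add, ← C_sub]; congr 1; linarith
    simp only [kernelPoly, zero_add, sum_range_one, div_eq_mul_inv, one_mul, C_mul, e]
    linear_combination C (h 0)⁻¹ * C (p 0) * h0
  | succ n ih =>
    have e : C (q (n + 1)) = C (p (n + 2)) + C (a (n + 1)) * C (p (n + 1)) +
        C (b (n + 1)) * C (p n) - C c * C (p (n + 1)) := by
      simp only [← C_mul, ← C_add, ← C_sub]; congr 1; linarith [hp n]
    have e2 : C (h n)⁻¹ = C (b (n + 1)) * C (h (n + 1))⁻¹ := by
      rw [← C_mul, ← hb n]; congr 1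
      have h1 := hne (n + 1)
      rw [← hb n] at h1
      have := hne n
      have := left_ne_zero_of_mul h1
      field_simp
    simp only [kernelPoly, div_eq_mul_inv, one_mul, C_mul] at ih ⊢
    rw [sum_range_succ _ (n + 1), sum_range_succ _ (n + 1)]
    simp only [e2] at ih
    simp only [e]
    linear_combination ih + C (h (n + 1))⁻¹ * C (p (n + 1)) * hrec n

theorem iterDeriv_succ (k : ℕ) (f : ℝ[X]) : iterDeriv (k + 1) f = derivative (iterDeriv k f) :=
  Function.iterate_succ_apply' _ _ _

theorem iterDeriv_X_mul (k : ℕ) (f : ℝ[X]) :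
    iterDeriv k (X * f) = X * iterDeriv k f + C (k : ℝ) * iterDeriv (k - 1) f := by
  induction k with
  | zero => simp [iterDeriv]
  | succ k ih =>
    rw [iterDeriv_succ, ih, iterDeriv_succ]
    cases k with
    | zero => simp [derivative_mul]; ring
    | succ k =>
      simp only [derivative_add, derivative_mul, derivative_X, derivative_C,
        Nat.add_sub_cancel, ← iterDeriv_succ]
      simp
      ring

/-- The functional `f ↦ f^{(k)}(c)`. -/
def evalIterDeriv (k : ℕ) (c : ℝ) : ℝ[X] →ₗ[ℝ] ℝ := leval c ∘ₗ derivative ^ k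

theorem evalIterDeriv_apply (k : ℕ) (c : ℝ) (f : ℝ[X]) :
    evalIterDeriv k c f = (iterDeriv k f).eval c := by
  simp [evalIterDeriv, iterDeriv, Module.End.pow_apply]

theorem evalIterDeriv_X_mul (k : ℕ) (c : ℝ) (f : ℝ[X]) :
    evalIterDeriv k c (X * f) =
      c * evalIterDeriv k c f + k * evalIterDeriv (k - 1) c f := by
  simp [evalIterDeriv_apply, iterDeriv_X_mul]

theorem evalIterDeriv_C_mul (k : ℕ) (c r : ℝ) (f : ℝ[X]) :
    evalIterDeriv k c (C r * f) = r * evalIterDeriv k c f := by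
  rw [← smul_eq_C_mul, map_smul, smul_eq_mul]

theorem kernelPoly_const_mul (n : ℕ) (r : ℝ) (F : ℕ → ℝ) :
    kernelPoly P h n (fun i => r * F i) = C r * kernelPoly P h n F := by
  simp only [kernelPoly, mul_sum, ← mul_assoc, ← C_mul, mul_div_assoc]

theorem taylorPoly_succ (k : ℕ) (c : ℝ) (f : ℝ[X]) :
    C ((k + 1).factorial : ℝ) * taylorPoly (k + 1) c f =
      C ((k : ℝ) + 1) * (C (k.factorial : ℝ) * taylorPoly k c f) +
        C (evalIterDeriv (k + 1) c f) * (X - C c) ^ (k + 1) := by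
  have hk : ((k + 1).factorial : ℝ) ≠ 0 := by positivity
  rw [taylorPoly, sum_range_succ, ← taylorPoly, mul_add, ← mul_assoc (C _) (C _) (_ ^ _), ← C_mul,
    mul_div_cancel₀ _ hk, evalIterDeriv_apply, ← mul_assoc, ← C_mul]
  congr 3
  push_cast [Nat.factorial_succ]
  rfl

/-- The derivatives of the Christoffel–Darboux kernel in terms of Taylor polynomials. -/
theorem X_sub_C_pow_mul_kernelPoly {a b : ℕ → ℝ} {a₀ : ℝ} (hne : ∀ m, h m ≠ 0)
    (h0 : X * P 0 = P 1 + C a₀ * P 0)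
    (hrec : ∀ m, X * P (m + 1) = P (m + 2) + C (a (m + 1)) * P (m + 1) + C (b (m + 1)) * P m)
    (hb : ∀ m, b (m + 1) * h m = h (m + 1)) (c : ℝ) (n k : ℕ) :
    (X - C c) ^ (k + 1) * kernelPoly P h (n + 1) (fun i => evalIterDeriv k c (P i)) =
      C (k.factorial / h n) *
        (taylorPoly k c (P n) * P (n + 1) - taylorPoly k c (P (n + 1)) * P n) := by
  have key (k : ℕ) := christoffelDarboux hne h0 hrec hb (c := c)
    (p := fun i => evalIterDeriv k c (P i)) (q := fun i => k * evalIterDeriv (k - 1) c (P i))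
    (by rw [← evalIterDeriv_X_mul, h0, map_add, evalIterDeriv_C_mul])
    (fun m => by
      rw [← evalIterDeriv_X_mul, hrec, map_add, map_add, evalIterDeriv_C_mul,
        evalIterDeriv_C_mul]) n
  induction k with
  | zero =>
    have := key 0
    rw [kernelPoly_const_mul] at this
    simpa [taylorPoly, ← evalIterDeriv_apply] using this
  | succ k ih =>
    have hk := key (k + 1)
    rw [kernelPoly_const_mul] at hk
    have t1 := taylorPoly_succ k c (P n)
    have t2 := taylorPoly_succ k c (P (n + 1))
    simp only [div_eq_mul_inv, C_mul, one_mul, Nat.add_sub_cancel, Nat.cast_add, Nat.cast_one]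
      at hk ih t1 t2 ⊢
    linear_combination (X - C c) ^ (k + 1) * hk + C ((k : ℝ) + 1) * ih
      - C (h n)⁻¹ * P (n + 1) * t1 + C (h n)⁻¹ * P n * t2

theorem isCoprime_of_recurrence {a b : ℕ → ℝ} (hP0 : P 0 = 1) (hbne : ∀ m, b (m + 1) ≠ 0)
    (hrec : ∀ m, X * P (m + 1) = P (m + 2) + C (a (m + 1)) * P (m + 1) + C (b (m + 1)) * P m)
    (n : ℕ) : IsCoprime (P n) (P (n + 1)) := by
  induction n with
  | zero => rw [hP0]; exact isCoprime_one_left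
  | succ n ih =>
    obtain ⟨u, v, huv⟩ := ih
    have e : C (b (n + 1))⁻¹ * C (b (n + 1)) = 1 := by
      rw [← C_mul, inv_mul_cancel₀ (hbne n), C_1]
    refine ⟨v + u * C (b (n + 1))⁻¹ * (X - C (a (n + 1))), -u * C (b (n + 1))⁻¹, ?_⟩
    linear_combination huv + u * C (b (n + 1))⁻¹ * hrec n + u * P n * e

/-- Expansion of a monic polynomial that is orthogonal for a discrete perturbation of `L`. -/
theorem eq_sub_sum_kernelPoly (hL : ∀ p, p ≠ 0 → 0 < L (p * p))
    (hPm : ∀ m, (P m).Monic) (hPd : ∀ m, (P m).natDegree = m)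
    (hPo : ∀ m l, m ≠ l → L (P m * P l) = 0)
    (hh : ∀ m, h m = L (P m * P m)) (hne : ∀ m, h m ≠ 0) {ι : Type*} (s : Finset ι)
    (w : ι → ℝ) (F : ι → ℝ[X] →ₗ[ℝ] ℝ) {S : ℝ[X]} {n : ℕ} (hSm : S.Monic)
    (hSd : S.natDegree = n)
    (hS : ∀ q : ℝ[X], q.degree < n → L (q * S) + ∑ i ∈ s, w i * F i q * F i S = 0) :
    S = P n - ∑ i ∈ s, C (w i * F i S) * kernelPoly P h n (fun m => F i (P m)) := by
  set E := S - P n + ∑ i ∈ s, C (w i * F i S) * kernelPoly P h n (fun m => F i (P m)) with hE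
  have hEdeg : E.degree < n := by
    rw [← mem_degreeLT]
    refine Submodule.add_mem _ (mem_degreeLT.2 (degree_lt_of_monic_sub hSm (hPm n) hSd (hPd n)))
      (Submodule.sum_mem _ fun i _ => ?_)
    rw [← smul_eq_C_mul]
    exact Submodule.smul_mem _ _ (mem_degreeLT.2 (degree_kernelPoly_lt hPd _ _ _))
  have hEP : ∀ m < n, L (E * P m) = 0 := by
    intro m hm
    have h1 := hS (P m) (by rw [degree_eq_natDegree (hPm m).ne_zero, hPd]; exact_mod_cast hm)
    rw [hE, add_mul, sub_mul, map_add, map_sub, hPo n m hm.ne', sum_mul, map_sum, mul_comm S]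
    have h2 : ∀ i ∈ s, L (C (w i * F i S) * kernelPoly P h n (fun m => F i (P m)) * P m) =
        w i * F i (P m) * F i S := fun i _ => by
      rw [mul_assoc, ← smul_eq_C_mul, map_smul, functional_kernelPoly_mul hPo hh hne _ hm,
        smul_eq_mul]
      ring
    rw [sum_congr rfl h2]
    linarith
  have hEE : L (E * E) = 0 :=
    LinearMap.eq_zero_of_monic_family (L ∘ₗ LinearMap.mulLeft ℝ E) hPm hPd hEP E hEdeg
  have hE0 : E = 0 := by
    by_contra hne0
    exact (hL E hne0).ne' hEE
  linear_combination hE0 - hE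

/-- Orthogonality to all polynomials of lower degree. -/
theorem functional_mul_eq_zero (hPm : ∀ m, (P m).Monic) (hPd : ∀ m, (P m).natDegree = m)
    (hPo : ∀ m l, m ≠ l → L (P m * P l) = 0) {n : ℕ} (q : ℝ[X]) (hq : q.degree < n) :
    L (P n * q) = 0 :=
  LinearMap.eq_zero_of_monic_family (L ∘ₗ LinearMap.mulLeft ℝ (P n)) hPm hPd
    (fun i hi => hPo n i hi.ne') q hq

/-- The squared norms determine the last recurrence coefficient. -/
theorem recurrence_coeff_mul (hPm : ∀ m, (P m).Monic) (hPd : ∀ m, (P m).natDegree = m)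
    (hPo : ∀ m l, m ≠ l → L (P m * P l) = 0) (hh : ∀ m, h m = L (P m * P m)) {a b : ℕ → ℝ}
    (hrec : ∀ m, X * P (m + 1) = P (m + 2) + C (a (m + 1)) * P (m + 1) + C (b (m + 1)) * P m)
    (m : ℕ) : b (m + 1) * h m = h (m + 1) := by
  have h1 : L (P (m + 1) * (X * P m)) = b (m + 1) * h m := by
    have e : P (m + 1) * (X * P m) =
        P (m + 2) * P m + a (m + 1) • (P (m + 1) * P m) + b (m + 1) • (P m * P m) := by
      simp only [smul_eq_C_mul]
      linear_combination P m * hrec m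
    rw [e, map_add, map_add, map_smul, map_smul, hPo _ _ (by omega), hPo _ _ (by omega), ← hh]
    simp
  have h2 : L (P (m + 1) * (X * P m - P (m + 1))) = 0 := by
    refine functional_mul_eq_zero hPm hPd hPo _
      (degree_lt_of_monic_sub (monic_X.mul (hPm m)) (hPm _) ?_ (hPd _))
    rw [monic_X.natDegree_mul (hPm m), hPd, natDegree_X, add_comm]
  rw [mul_sub, map_sub, h1, ← hh] at h2
  linarith

/-- The diagonal Sobolev norm of `S` written with the unperturbed family is positive. -/
theorem norm_add_sum_pos (hL : ∀ p, p ≠ 0 → 0 < L (p * p))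
    (hPm : ∀ m, (P m).Monic) (hPd : ∀ m, (P m).natDegree = m)
    (hPo : ∀ m l, m ≠ l → L (P m * P l) = 0)
    (hh : ∀ m, h m = L (P m * P m)) {ι : Type*} (s : Finset ι)
    {w : ι → ℝ} (hw : ∀ i ∈ s, 0 ≤ w i) (F : ι → ℝ[X] →ₗ[ℝ] ℝ) {S : ℝ[X]} {n : ℕ}
    (hSm : S.Monic) (hSd : S.natDegree = n)
    (hS : ∀ q : ℝ[X], q.degree < n → L (q * S) + ∑ i ∈ s, w i * F i q * F i S = 0) :
    0 < h n + ∑ i ∈ s, w i * F i (P n) * F i S := by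
  have hdeg := degree_lt_of_monic_sub hSm (hPm n) hSd (hPd n)
  have h1 := hS _ hdeg
  have h2 := functional_mul_eq_zero hPm hPd hPo _ hdeg
  rw [mul_sub, map_sub, ← hh] at h2
  simp only [map_sub, sub_mul, mul_sub, sum_sub_distrib] at h1
  have h3 : 0 ≤ ∑ i ∈ s, w i * F i S * F i S := sum_nonneg fun i hi => by
    rw [mul_assoc]
    exact mul_nonneg (hw i hi) (mul_self_nonneg _)
  have h4 := hL S hSm.ne_zero
  linarith

end OrthogonalPolynomials

section Connection

/-- The common shape of the sums in the connection coefficients. -/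
def connectionSum {ι : Type*} (s : Finset ι) (t : ι → ℝ) (k : ι → ℕ) (c : ι → ℝ) (R : ι → ℝ[X])
    (f : ℝ[X]) : ℝ[X] :=
  ∑ i ∈ s, C (t i) * (taylorPoly (k i) (c i) f * R i)

theorem connection_formula {L : ℝ[X] →ₗ[ℝ] ℝ} {P : ℕ → ℝ[X]} {h : ℕ → ℝ}
    (hL : ∀ p, p ≠ 0 → 0 < L (p * p))
    (hPm : ∀ m, (P m).Monic) (hPd : ∀ m, (P m).natDegree = m)
    (hPo : ∀ m l, m ≠ l → L (P m * P l) = 0)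
    (hh : ∀ m, h m = L (P m * P m)) (hne : ∀ m, h m ≠ 0) {a b : ℕ → ℝ} {a₀ : ℝ}
    (h0 : X * P 0 = P 1 + C a₀ * P 0)
    (hrec : ∀ m, X * P (m + 1) = P (m + 2) + C (a (m + 1)) * P (m + 1) + C (b (m + 1)) * P m)
    {ι : Type*} (s : Finset ι) (w : ι → ℝ) (k : ι → ℕ) (c : ι → ℝ) (R : ι → ℝ[X]) {ρ : ℝ[X]}
    (hR : ∀ i ∈ s, (X - C (c i)) ^ (k i + 1) * R i = ρ) {S : ℝ[X]} {m : ℕ} (hSm : S.Monic)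
    (hSd : S.natDegree = m + 1)
    (hS : ∀ q : ℝ[X], q.degree < (m + 1 : ℕ) → L (q * S) +
      ∑ i ∈ s, w i * evalIterDeriv (k i) (c i) q * evalIterDeriv (k i) (c i) S = 0)
    {t : ι → ℝ}
    (ht : ∀ i, t i = (k i).factorial * w i * evalIterDeriv (k i) (c i) S / h m) :
    ρ * S = (ρ - connectionSum s t k c R (P m)) * P (m + 1) +
      connectionSum s t k c R (P (m + 1)) * P m := by
  have hb := recurrence_coeff_mul hPm hPd hPo hh hrec
  have hexp := eq_sub_sum_kernelPoly hL hPm hPd hPo hh hne s w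
    (fun i => evalIterDeriv (k i) (c i)) hSm hSd hS
  have hsum : ρ * ∑ i ∈ s, C (w i * evalIterDeriv (k i) (c i) S) *
        kernelPoly P h (m + 1) (fun l => evalIterDeriv (k i) (c i) (P l)) =
      connectionSum s t k c R (P m) * P (m + 1) - connectionSum s t k c R (P (m + 1)) * P m := by
    rw [connectionSum, connectionSum, sum_mul, sum_mul, mul_sum, ← sum_sub_distrib]
    refine sum_congr rfl fun i hi => ?_
    have hK := X_sub_C_pow_mul_kernelPoly hne h0 hrec hb (c i) m (k i)
    rw [ht, ← hR i hi]
    simp only [div_eq_mul_inv, C_mul] at hK ⊢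
    linear_combination C (w i) * C (evalIterDeriv (k i) (c i) S) * R i * hK
  linear_combination ρ * hexp - hsum

theorem natDegree_taylorPoly_le (k : ℕ) (c : ℝ) (f : ℝ[X]) : (taylorPoly k c f).natDegree ≤ k := by
  refine natDegree_sum_le_of_forall_le _ _ fun ν hν => ?_
  refine (natDegree_C_mul_le _ _).trans ?_
  rw [natDegree_pow, natDegree_X_sub_C, mul_one]
  have := mem_range.1 hν
  omega

theorem coeff_taylorPoly (k : ℕ) (c : ℝ) (f : ℝ[X]) :
    (taylorPoly k c f).coeff k = evalIterDeriv k c f / k.factorial := by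
  have hm : ((X - C c) ^ k).coeff k = 1 := by
    have := ((monic_X_sub_C c).pow k).coeff_natDegree
    rwa [natDegree_pow, natDegree_X_sub_C, mul_one] at this
  rw [taylorPoly, finsetSum_coeff, sum_range_succ, sum_eq_zero, zero_add, coeff_C_mul, hm,
    mul_one, evalIterDeriv_apply]
  intro ν hν
  rw [coeff_C_mul, coeff_eq_zero_of_natDegree_lt, mul_zero]
  rw [natDegree_pow, natDegree_X_sub_C, mul_one]
  exact mem_range.1 hν

theorem natDegree_connectionSum_le {ι : Type*} {s : Finset ι} (t : ι → ℝ) {k : ι → ℕ} (c : ι → ℝ)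
    {R : ι → ℝ[X]} {e : ℕ} (hRd : ∀ i ∈ s, k i + (R i).natDegree = e) (f : ℝ[X]) :
    (connectionSum s t k c R f).natDegree ≤ e := by
  refine natDegree_sum_le_of_forall_le _ _ fun i hi => ?_
  refine (natDegree_C_mul_le _ _).trans (natDegree_mul_le.trans ?_)
  have := natDegree_taylorPoly_le (k i) (c i) f
  have := hRd i hi
  omega

theorem coeff_connectionSum {ι : Type*} {s : Finset ι} (t : ι → ℝ) {k : ι → ℕ} (c : ι → ℝ)
    {R : ι → ℝ[X]} {e : ℕ} (hRm : ∀ i ∈ s, (R i).Monic)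
    (hRd : ∀ i ∈ s, k i + (R i).natDegree = e) (f : ℝ[X]) :
    (connectionSum s t k c R f).coeff e =
      ∑ i ∈ s, t i * (evalIterDeriv (k i) (c i) f / (k i).factorial) := by
  rw [connectionSum, finsetSum_coeff]
  refine sum_congr rfl fun i hi => ?_
  rw [coeff_C_mul, ← hRd i hi,
    coeff_mul_add_eq_of_natDegree_le (natDegree_taylorPoly_le _ _ _) le_rfl, coeff_taylorPoly,
    (hRm i hi).coeff_natDegree, mul_one]

variable {N : ℕ} (c : Fin N → ℝ) (dd : Fin N → ℕ)

theorem monic_rhoPoly : (rhoPoly c dd).Monic :=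
  monic_prod_of_monic _ _ fun j _ => (monic_X_sub_C (c j)).pow _

theorem natDegree_rhoPoly : (rhoPoly c dd).natDegree = ∑ j, (dd j + 1) := by
  rw [rhoPoly, natDegree_prod_of_monic _ _ fun j _ => (monic_X_sub_C (c j)).pow _]
  simp

theorem monic_rhoJK (j : Fin N) (k : ℕ) : (rhoJK c dd j k).Monic :=
  ((monic_X_sub_C (c j)).pow _).mul
    (monic_prod_of_monic _ _ fun i _ => (monic_X_sub_C (c i)).pow _)

theorem X_sub_C_pow_mul_rhoJK (j : Fin N) {k : ℕ} (hk : k ≤ dd j) :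
    (X - C (c j)) ^ (k + 1) * rhoJK c dd j k = rhoPoly c dd := by
  rw [rhoJK, rhoPoly, ← mul_prod_erase univ _ (mem_univ j), ← mul_assoc, ← pow_add]
  congr 2
  omega

theorem add_natDegree_rhoJK (j : Fin N) {k : ℕ} (hk : k ≤ dd j) :
    k + 1 + (rhoJK c dd j k).natDegree = ∑ j, (dd j + 1) := by
  rw [← natDegree_rhoPoly c, ← X_sub_C_pow_mul_rhoJK c dd j hk,
    ((monic_X_sub_C (c j)).pow _).natDegree_mul (monic_rhoJK c dd j k), natDegree_pow,
    natDegree_X_sub_C, mul_one]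

end Connection

section ConnectionDeterminant

theorem natDegree_det_eq {A B C' D : ℝ[X]} {e : ℕ} (hA : A.natDegree ≤ e + 1)
    (hA1 : A.coeff (e + 1) = 1) (hB : B.natDegree ≤ e) (hC : C'.natDegree ≤ e)
    (hD : D.natDegree ≤ e + 1) (hD0 : D.coeff (e + 1) ≠ 0) :
    (A * D - B * C').natDegree = 2 * (e + 1) := by
  have hBC : (B * C').natDegree ≤ 2 * e := natDegree_mul_le.trans (by omega)
  refine natDegree_eq_of_le_of_coeff_ne_zero ?_ ?_
  · exact (natDegree_sub_le _ _).trans (max_le (natDegree_mul_le.trans (by omega)) (by omega))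
  · rw [coeff_sub, coeff_eq_zero_of_natDegree_lt (show (B * C').natDegree < _ by omega), sub_zero,
      two_mul, coeff_mul_add_eq_of_natDegree_le hA hD, hA1, one_mul]
    exact hD0

end ConnectionDeterminant

theorem stmt11 (α β : ℝ) (hα : -1 < α) (hβ : -1 < β)
    (N : ℕ) (hN : 1 ≤ N)
    (c : Fin N → ℝ) (hc : Function.Injective c) (hcout : ∀ j, c j ∉ Set.Ioo (-1 : ℝ) 1)
    (dd : Fin N → ℕ) (hdd : Monotone dd)
    (lam : Fin N → ℕ → ℝ) (hlam : ∀ j k, 0 ≤ lam j k) (hlamd : ∀ j, 0 < lam j (dd j))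
    (d : ℕ) (hd : d = ∑ j, (dd j + 1))
    (P : ℕ → Polynomial ℝ) (hPm : ∀ m, (P m).Monic) (hPd : ∀ m, (P m).natDegree = m)
    (hPo : ∀ m l, m ≠ l → ∫ x, (P m).eval x * (P l).eval x ∂(jacobiMeasure α β) = 0)
    (h : ℕ → ℝ) (hh : ∀ m, h m = ∫ x, ((P m).eval x) ^ 2 ∂(jacobiMeasure α β))
    (S : ℕ → Polynomial ℝ) (hSm : ∀ m, (S m).Monic) (hSd : ∀ m, (S m).natDegree = m)
    (hSo : ∀ m l, l < m → sobolevIP α β c dd lam (X ^ l) (S m) = 0)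
    (A2 B2 : ℕ → Polynomial ℝ)
    (hA2 : ∀ m, 1 ≤ m → A2 m = rhoPoly c dd -
      ∑ j : Fin N, ∑ k ∈ Finset.range (dd j + 1),
        Polynomial.C ((Nat.factorial k : ℝ) * lam j k * (iterDeriv k (S m)).eval (c j) / h (m - 1)) *
          (taylorPoly k (c j) (P (m - 1)) * rhoJK c dd j k))
    (hB2 : ∀ m, 1 ≤ m → B2 m =
      ∑ j : Fin N, ∑ k ∈ Finset.range (dd j + 1),
        Polynomial.C ((Nat.factorial k : ℝ) * lam j k * (iterDeriv k (S m)).eval (c j) / h (m - 1)) *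
          (taylorPoly k (c j) (P m) * rhoJK c dd j k))
    (hrec : ∀ m, 1 ≤ m → X * P m =
      P (m + 1) + Polynomial.C (gamma1 α β m) * P m + Polynomial.C (gamma2 α β m) * P (m - 1))
    (C2 D2 : ℕ → Polynomial ℝ)
    (hC2 : ∀ m, 2 ≤ m → C2 m = Polynomial.C (-(1 / gamma2 α β (m - 1))) * B2 (m - 1))
    (hD2 : ∀ m, 2 ≤ m → D2 m = A2 (m - 1) +
      Polynomial.C (1 / gamma2 α β (m - 1)) * B2 (m - 1) * (X - Polynomial.C (gamma1 α β (m - 1))))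
    (n : ℕ) (hn : 2 ≤ n) :
    (A2 n * D2 n - B2 n * C2 n) * P n =
        rhoPoly c dd * (D2 n * S n - B2 n * S (n - 1)) ∧
      (A2 n * D2 n - B2 n * C2 n) * P (n - 1) =
        rhoPoly c dd * (A2 n * S (n - 1) - C2 n * S n) ∧
      rhoPoly c dd ∣ (A2 n * D2 n - B2 n * C2 n) ∧
      (d + 1 ≤ n → (A2 n * D2 n - B2 n * C2 n).natDegree = 2 * d) := by
  let L := jacobiFunctional hα hβ
  have hL : ∀ p, p ≠ 0 → 0 < L (p * p) := fun p hp => jacobiFunctional_mul_self_pos hα hβ hp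
  have hPo' : ∀ m l, m ≠ l → L (P m * P l) = 0 := fun m l hml => by
    simpa [L, jacobiFunctional] using hPo m l hml
  have hh' : ∀ m, h m = L (P m * P m) := fun m => by
    simp [L, jacobiFunctional, hh, sq]
  have hpos : ∀ m, 0 < h m := fun m => hh' m ▸ hL _ (hPm m).ne_zero
  have hne : ∀ m, h m ≠ 0 := fun m => (hpos m).ne'
  have hrec' (m : ℕ) : X * P (m + 1) = P (m + 2) + C (gamma1 α β (m + 1)) * P (m + 1) +
      C (gamma2 α β (m + 1)) * P m := hrec (m + 1) (by omega)
  have hP0 : P 0 = 1 := eq_one_of_monic_natDegree_zero (hPm 0) (hPd 0)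
  have hP1 : X * P 0 = P 1 + C (-(P 1).coeff 0) * P 0 := by
    have := (hPm 1).eq_X_add_C (hPd 1)
    rw [hP0, C_neg]
    linear_combination -this
  have hγ (m : ℕ) : gamma2 α β (m + 1) * h m = h (m + 1) :=
    recurrence_coeff_mul hPm hPd hPo' hh' (a := gamma1 α β) (b := gamma2 α β) hrec' m
  have hγne (m : ℕ) : gamma2 α β (m + 1) ≠ 0 := left_ne_zero_of_mul (hγ m ▸ hne (m + 1))
  let s : Finset (Σ _ : Fin N, ℕ) := univ.sigma fun j => range (dd j + 1)
  have hs : ∀ i ∈ s, i.2 ≤ dd i.1 := fun i hi => by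
    have := (mem_sigma.1 hi).2
    rw [mem_range] at this
    omega
  let w : (Σ _ : Fin N, ℕ) → ℝ := fun i => lam i.1 i.2
  let k : (Σ _ : Fin N, ℕ) → ℕ := fun i => i.2
  let c' : (Σ _ : Fin N, ℕ) → ℝ := fun i => c i.1
  let R : (Σ _ : Fin N, ℕ) → ℝ[X] := fun i => rhoJK c dd i.1 i.2
  have hS (m : ℕ) (q : ℝ[X]) (hq : q.degree < m) : L (q * S m) +
      ∑ i ∈ s, w i * evalIterDeriv (k i) (c' i) q * evalIterDeriv (k i) (c' i) (S m) = 0 := by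
    have := LinearMap.eq_zero_of_monic_family (P := fun l => X ^ l) (n := m)
      (L ∘ₗ LinearMap.mulRight ℝ (S m) +
        ∑ i ∈ s, (w i * evalIterDeriv (k i) (c' i) (S m)) • evalIterDeriv (k i) (c' i))
      (fun l => monic_X_pow l) (fun l => natDegree_X_pow l) ?_ q hq
    · simpa [LinearMap.sum_apply, mul_right_comm] using this
    · intro l hl
      have := hSo m l hl
      rw [sobolevIP, sum_sigma'] at this
      simpa [LinearMap.sum_apply, evalIterDeriv_apply, L, jacobiFunctional, s, w, k, c',
        mul_right_comm] using this
  let t : ℕ → (Σ _ : Fin N, ℕ) → ℝ := fun m i =>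
    (k i).factorial * w i * evalIterDeriv (k i) (c' i) (S (m + 1)) / h m
  let T : ℕ → ℝ[X] → ℝ[X] := fun m => connectionSum s (t m) k c' R
  have hA (m : ℕ) : A2 (m + 1) = rhoPoly c dd - T m (P m) := by
    rw [hA2 _ (by omega), sum_sigma']
    simp only [T, connectionSum, t, evalIterDeriv_apply, s, w, k, c', R, Nat.add_sub_cancel]
  have hB (m : ℕ) : B2 (m + 1) = T m (P (m + 1)) := by
    rw [hB2 _ (by omega), sum_sigma']
    simp only [T, connectionSum, t, evalIterDeriv_apply, s, w, k, c', R, Nat.add_sub_cancel]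
  have hconn (m : ℕ) : rhoPoly c dd * S (m + 1) = A2 (m + 1) * P (m + 1) + B2 (m + 1) * P m := by
    rw [hA, hB]
    exact connection_formula hL hPm hPd hPo' hh' hne hP1 (a := gamma1 α β) (b := gamma2 α β) hrec'
      s w k c' R (fun i hi => X_sub_C_pow_mul_rhoJK c dd i.1 (hs i hi)) (hSm _) (hSd _) (hS _)
      (fun _ => rfl)
  obtain ⟨m, rfl⟩ : ∃ m, n = m + 2 := ⟨n - 2, by omega⟩
  have hC := hC2 (m + 2) hn
  have hD := hD2 (m + 2) hn
  simp only [show m + 2 - 1 = m + 1 by omega, one_div, C_neg] at hC hD ⊢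
  have hconn1 := hconn (m + 1)
  have hγinv : C (gamma2 α β (m + 1))⁻¹ * C (gamma2 α β (m + 1)) = 1 := by
    rw [← C_mul, inv_mul_cancel₀ (hγne m), C_1]
  have hconn2 : rhoPoly c dd * S (m + 1) = C2 (m + 2) * P (m + 2) + D2 (m + 2) * P (m + 1) := by
    rw [hC, hD]
    linear_combination hconn m - C (gamma2 α β (m + 1))⁻¹ * B2 (m + 1) * hrec' m
      - B2 (m + 1) * P m * hγinv
  have id1 : (A2 (m + 2) * D2 (m + 2) - B2 (m + 2) * C2 (m + 2)) * P (m + 2) =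
      rhoPoly c dd * (D2 (m + 2) * S (m + 2) - B2 (m + 2) * S (m + 1)) := by
    linear_combination B2 (m + 2) * hconn2 - D2 (m + 2) * hconn1
  have id2 : (A2 (m + 2) * D2 (m + 2) - B2 (m + 2) * C2 (m + 2)) * P (m + 1) =
      rhoPoly c dd * (A2 (m + 2) * S (m + 1) - C2 (m + 2) * S (m + 2)) := by
    linear_combination C2 (m + 2) * hconn1 - A2 (m + 2) * hconn2
  refine ⟨id1, id2, ?_, fun _ => ?_⟩
  · obtain ⟨u, v, huv⟩ := isCoprime_of_recurrence (a := gamma1 α β) (b := gamma2 α β)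
      hP0 hγne hrec' (m + 1)
    refine ⟨u * (A2 (m + 2) * S (m + 1) - C2 (m + 2) * S (m + 2)) +
      v * (D2 (m + 2) * S (m + 2) - B2 (m + 2) * S (m + 1)), ?_⟩
    linear_combination u * id2 + v * id1 -
      (A2 (m + 2) * D2 (m + 2) - B2 (m + 2) * C2 (m + 2)) * huv
  · have hρd : (rhoPoly c dd).natDegree = d := by rw [natDegree_rhoPoly, hd]
    obtain ⟨e, he⟩ : ∃ e, d = e + 1 := by
      have := add_natDegree_rhoJK c dd ⟨0, hN⟩ (Nat.zero_le _)
      exact ⟨d - 1, by omega⟩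
    rw [he] at hρd ⊢
    have hRd : ∀ i ∈ s, k i + (R i).natDegree = e := fun i hi => by
      have : k i + 1 + (R i).natDegree = _ := add_natDegree_rhoJK c dd i.1 (hs i hi)
      omega
    have hT (l : ℕ) (f : ℝ[X]) : (T l f).natDegree ≤ e := natDegree_connectionSum_le _ _ hRd f
    have hAd (l : ℕ) : (A2 (l + 1)).natDegree ≤ e + 1 := by
      rw [hA]
      exact (natDegree_sub_le _ _).trans (max_le hρd.le ((hT _ _).trans (by omega)))
    have hA1 (l : ℕ) : (A2 (l + 1)).coeff (e + 1) = 1 := by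
      have := (monic_rhoPoly c dd).coeff_natDegree
      rw [hρd] at this
      rw [hA, coeff_sub, this, coeff_eq_zero_of_natDegree_lt (Nat.lt_succ_of_le (hT _ _)), sub_zero]
    have hBd (l : ℕ) : (B2 (l + 1)).natDegree ≤ e := by rw [hB]; exact hT _ _
    have hBγ : (C (gamma2 α β (m + 1))⁻¹ * B2 (m + 1)).natDegree ≤ e :=
      (natDegree_C_mul_le _ _).trans (hBd m)
    have hBe : h m * (B2 (m + 1)).coeff e =
        ∑ i ∈ s, w i * evalIterDeriv (k i) (c' i) (P (m + 1)) *
          evalIterDeriv (k i) (c' i) (S (m + 1)) := by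
      rw [hB, coeff_connectionSum _ _ (fun i _ => monic_rhoJK c dd i.1 i.2) hRd, mul_sum]
      refine sum_congr rfl fun i _ => ?_
      have h1 := hne m
      have h2 : ((k i).factorial : ℝ) ≠ 0 := by positivity
      simp only [t]
      field_simp
    refine natDegree_det_eq (hAd _) (hA1 _) (hBd _) ?_ ?_ ?_
    · rw [hC, neg_mul, natDegree_neg]
      exact hBγ
    · rw [hD]
      refine (natDegree_add_le _ _).trans (max_le (hAd m) ?_)
      exact natDegree_mul_le.trans (add_le_add hBγ (natDegree_X_sub_C_le _))
    · have hnorm := norm_add_sum_pos hL hPm hPd hPo' hh' s (fun i _ => hlam i.1 i.2)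
        (fun i => evalIterDeriv (k i) (c' i)) (hSm (m + 1)) (hSd _) (hS _)
      have hX : (X - C (gamma1 α β (m + 1)) : ℝ[X]).coeff 1 = 1 := by simp [coeff_X]
      rw [hD, coeff_add, hA1, coeff_mul_add_eq_of_natDegree_le hBγ (natDegree_X_sub_C_le _),
        coeff_C_mul, hX, mul_one]
      intro h0
      refine hnorm.ne' ?_
      have h1 := hγne m
      rw [← hBe, ← hγ m]
      field_simp at h0
      linear_combination h m * h0
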